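/- The real number (√2)^(√2) is irrational. -/

import Mathlib

open Polynomial in
theorem rolle_finset (f : ℝ → ℝ) (hf : Differentiable ℝ f) (S : Finset ℝ) :
    (∀ x ∈ S, f x = 0) → ∃ T : Finset ℝ, S.card ≤ T.card + 1 ∧
      ∀ z ∈ T, deriv f z = 0 ∧ ∃ x ∈ S, ∃ y ∈ S, x < z ∧ z < y := by
  induction S using Finset.induction_on_max with
  | empty => intro _; exact ⟨∅, by simp⟩
  | insert a s hs ih =>
    intro h
    obtain ⟨T, hc, hT⟩ := ih (fun x hx => h x (Finset.mem_insert_of_mem hx))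
    have ha : a ∉ s := fun h => lt_irrefl _ (hs a h)
    rcases s.eq_empty_or_nonempty with rfl | hne
    · exact ⟨∅, by simp⟩
    · set b := s.max' hne with hb
      have hbs : b ∈ s := s.max'_mem hne
      obtain ⟨z, hz, hz'⟩ := exists_deriv_eq_zero (f := f) (hs b hbs)
        hf.continuous.continuousOn
        ((h b (Finset.mem_insert_of_mem hbs)).trans (h a (Finset.mem_insert_self _ _)).symm)
      have hzT : z ∉ T := by
        intro hzT
        obtain ⟨-, x, hx, y, hy, h1, h2⟩ := hT z hzT
        have := s.le_max' y hy
        have := hz.1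
        linarith
      refine ⟨insert z T, ?_, ?_⟩
      · rw [Finset.card_insert_of_notMem ha, Finset.card_insert_of_notMem hzT]; omega
      · intro t ht
        rcases Finset.mem_insert.1 ht with rfl | ht
        · exact ⟨hz', b, Finset.mem_insert_of_mem hbs, a, Finset.mem_insert_self _ _, hz.1, hz.2⟩
        · obtain ⟨h0, x, hx, y, hy, h1⟩ := hT t ht
          exact ⟨h0, x, Finset.mem_insert_of_mem hx, y, Finset.mem_insert_of_mem hy, h1⟩

theorem rolle_iter (a b : ℝ) (n : ℕ) : ∀ (f : ℝ → ℝ), ContDiff ℝ (⊤ : ℕ∞) f → ∀ S : Finset ℝ,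
    n + 1 ≤ S.card → (∀ x ∈ S, f x = 0 ∧ x ∈ Set.Icc a b) →
    ∃ ξ ∈ Set.Icc a b, iteratedDeriv n f ξ = 0 := by
  induction n with
  | zero =>
    intro f hf S hS h
    obtain ⟨x, hx⟩ := Finset.card_pos.1 (by omega : 0 < S.card)
    exact ⟨x, (h x hx).2, by simpa using (h x hx).1⟩
  | succ n ih =>
    intro f hf S hS h
    obtain ⟨T, hc, hT⟩ := rolle_finset f (hf.differentiable (by simp)) S (fun x hx => (h x hx).1)
    rw [iteratedDeriv_succ']
    refine ih (deriv f) ?_ T (by omega) ?_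
    · exact (contDiff_infty_iff_deriv.1 hf).2
    · intro z hz
      obtain ⟨h0, x, hx, y, hy, h1, h2⟩ := hT z hz
      exact ⟨h0, (h x hx).2.1.trans h1.le, h2.le.trans (h y hy).2.2⟩

open Polynomial in
theorem interp_bound (X D : ℝ) (n : ℕ) (f : ℝ → ℝ) (hf : ContDiff ℝ (⊤ : ℕ∞) f) (S : Finset ℝ)
    (hn : S.card = n) (hS : ∀ x ∈ S, f x = 0 ∧ x ∈ Set.Icc 0 X)
    (hD : ∀ x ∈ Set.Icc 0 X, |iteratedDeriv n f x| ≤ D) (x : ℝ) (hx : x ∈ Set.Icc 0 X) :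
    |f x| ≤ X ^ n * D / (n.factorial : ℝ) := by
  have hX : 0 ≤ X := hx.1.trans hx.2
  have hD0 : 0 ≤ D := (abs_nonneg _).trans (hD x hx)
  by_cases hxS : x ∈ S
  · rw [(hS x hxS).1, abs_zero]; positivity
  set Q : ℝ[X] := ∏ s ∈ S, (Polynomial.X - Polynomial.C s) with hQ
  have hQm : Q.Monic := monic_prod_of_monic _ _ (fun s _ => monic_X_sub_C s)
  have hQd : Q.natDegree = n := by
    rw [hQ, natDegree_prod_of_monic _ _ (fun s _ => monic_X_sub_C s)]; simp [hn]
  have hQe : ∀ t, Q.eval t = ∏ s ∈ S, (t - s) := by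
    intro t; rw [hQ, eval_prod]; simp
  have hQn : ∀ t, iteratedDeriv n (fun t => Q.eval t) t = n.factorial := by
    intro t
    have h1 : ∀ k, iteratedDeriv k (fun t => Q.eval t) = fun t => (derivative^[k] Q).eval t := by
      intro k
      induction k with
      | zero => simp
      | succ k ih =>
        rw [iteratedDeriv_succ, ih]
        funext t
        rw [Function.iterate_succ_apply', Polynomial.deriv]
    rw [h1]
    have h2 : derivative^[n] Q = C (n.factorial : ℝ) := by
      have h3 : (derivative^[n] Q).natDegree ≤ 0 := by
        have := Polynomial.natDegree_iterate_derivative Q n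
        omega
      rw [Polynomial.eq_C_of_natDegree_le_zero h3, Polynomial.coeff_iterate_derivative]
      have : Q.coeff n = 1 := by rw [← hQd]; exact hQm
      simp [this, Nat.descFactorial_self]
    simp [h2]
  have hw : Q.eval x ≠ 0 := by
    rw [hQe, Finset.prod_ne_zero_iff]
    intro s hs h0
    exact hxS (by rwa [sub_eq_zero.1 h0])
  have hwle : |Q.eval x| ≤ X ^ n := by
    rw [hQe, Finset.abs_prod, ← hn, ← Finset.prod_const]
    apply Finset.prod_le_prod
    · intros; positivity
    · intro s hs
      have := (hS s hs).2
      rw [abs_le]; constructor <;> linarith [this.1, this.2, hx.1, hx.2]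
  have hQc : ContDiff ℝ (⊤ : ℕ∞) (fun t => Q.eval t) := by simpa using Q.contDiff_aeval (𝕜 := ℝ) (⊤ : ℕ∞)
  have hg : ContDiff ℝ (⊤ : ℕ∞) ((fun t => Q.eval x * f t) - fun t => f x * Q.eval t) :=
    (contDiff_const.mul hf).sub (contDiff_const.mul hQc)
  obtain ⟨ξ, hξ, h0⟩ := rolle_iter 0 X n _ hg (insert x S)
    (by rw [Finset.card_insert_of_notMem hxS, hn]) (by
      intro t ht
      rcases Finset.mem_insert.1 ht with rfl | ht
      · exact ⟨by simp [mul_comm], hx⟩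
      · refine ⟨?_, (hS t ht).2⟩
        have : Q.eval t = 0 := by
          rw [hQe]; exact Finset.prod_eq_zero ht (sub_self t)
        simp [this, (hS t ht).1])
  have hle : ((n : ℕ∞) : WithTop ℕ∞) ≤ ((⊤ : ℕ∞) : WithTop ℕ∞) := by exact_mod_cast le_top
  rw [iteratedDeriv_sub ((contDiff_const.mul hf).contDiffAt.of_le hle)
    ((contDiff_const.mul hQc).contDiffAt.of_le hle),
    iteratedDeriv_const_mul_field, iteratedDeriv_const_mul_field, hQn] at h0
  have hfac : (0 : ℝ) < n.factorial := by exact_mod_cast n.factorial_pos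
  rw [le_div_iff₀ hfac]
  have : f x * n.factorial = Q.eval x * iteratedDeriv n f ξ := by linarith
  calc |f x| * n.factorial = |f x * n.factorial| := by rw [abs_mul, abs_of_pos hfac]
    _ = |Q.eval x| * |iteratedDeriv n f ξ| := by rw [this, abs_mul]
    _ ≤ X ^ n * D := mul_le_mul hwle (hD ξ hξ) (abs_nonneg _) (by positivity)

open Polynomial in
theorem exp_poly_zeros (n : ℕ) : ∀ (s : Finset ℝ) (P : ℝ → ℝ[X]) (S : Finset ℝ),
    (∀ l ∈ s, P l ≠ 0) → s.Nonempty → ∑ l ∈ s, ((P l).natDegree + 1) ≤ n → 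
    (∀ x ∈ S, ∑ l ∈ s, (P l).eval x * Real.exp (l * x) = 0) → S.card < n := by
  induction n with
  | zero =>
    intro s P S hP hs hn
    obtain ⟨l, hl⟩ := hs
    have := Finset.single_le_sum (f := fun l => (P l).natDegree + 1) (fun _ _ => Nat.zero_le _) hl
    omega
  | succ n ih =>
    intro s P S hP hs hn h0
    obtain ⟨m, hm⟩ := hs
    -- derivative of exp(-m x) f
    let R : ℝ → ℝ[X] := fun l => derivative (P l) + C (l - m) * P l
    have hder : ∀ x, HasDerivAt (fun x => ∑ l ∈ s, (P l).eval x * Real.exp ((l - m) * x))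
        (∑ l ∈ s, (R l).eval x * Real.exp ((l - m) * x)) x := by
      intro x
      refine HasDerivAt.fun_sum fun l _ => ?_
      have h1 := (P l).hasDerivAt x
      have h2 : HasDerivAt (fun x => Real.exp ((l - m) * x))
          (Real.exp ((l - m) * x) * ((l - m) * 1)) x :=
        ((hasDerivAt_id x).const_mul (l - m)).exp
      refine (h1.mul h2).congr_deriv ?_
      simp [R]; ring
    have hz : ∀ x, ∀ A : ℝ → ℝ[X], ∑ l ∈ s, (A l).eval x * Real.exp ((l - m) * x) =
        Real.exp (-m * x) * ∑ l ∈ s, (A l).eval x * Real.exp (l * x) := by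
      intro x A
      rw [Finset.mul_sum]
      refine Finset.sum_congr rfl fun l _ => ?_
      rw [show (l - m) * x = -m * x + l * x by ring, Real.exp_add]; ring
    obtain ⟨T, hc, hT⟩ := rolle_finset _ (fun x => (hder x).differentiableAt) S (by
      intro x hx; rw [hz, h0 x hx, mul_zero])
    have hT0 : ∀ x ∈ T, ∑ l ∈ s, (R l).eval x * Real.exp (l * x) = 0 := by
      intro x hx
      have := (hT x hx).1
      rw [(hder x).deriv, hz] at this
      exact (mul_eq_zero.1 this).resolve_left (Real.exp_ne_zero _)
    have hRm : R m = derivative (P m) := by simp [R]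
    have hRd : ∀ l ∈ s, l ≠ m → R l ≠ 0 ∧ (R l).natDegree = (P l).natDegree := by
      intro l hl hlm
      have hd : (derivative (P l)).degree < (C (l - m) * P l).degree := by
        rw [degree_C_mul (sub_ne_zero.2 hlm)]
        exact degree_derivative_lt (hP l hl)
      have h1 : (R l).degree = (P l).degree := by
        simp only [R]
        rw [degree_add_eq_right_of_degree_lt hd, degree_C_mul (sub_ne_zero.2 hlm)]
      refine ⟨?_, natDegree_eq_of_degree_eq h1⟩
      intro h
      rw [h, degree_zero] at h1
      exact hP l hl (degree_eq_bot.1 h1.symm)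
    have hsum : ∑ l ∈ s.erase m, ((R l).natDegree + 1) = ∑ l ∈ s.erase m, ((P l).natDegree + 1) :=
      Finset.sum_congr rfl fun l hl => by
        rw [(hRd l (Finset.mem_of_mem_erase hl) (Finset.ne_of_mem_erase hl)).2]
    rw [← Finset.add_sum_erase s _ hm] at hn
    by_cases hdeg : (P m).natDegree = 0
    · have hR0 : R m = 0 := by rw [hRm]; exact derivative_of_natDegree_zero hdeg
      rcases (s.erase m).eq_empty_or_nonempty with he | hne
      · -- f is a constant times exp
        have hs1 : s = {m} := by
          rw [← Finset.insert_erase hm, he]; rfl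
        have : S = ∅ := by
          rw [Finset.eq_empty_iff_forall_notMem]
          intro x hx
          have := h0 x hx
          rw [hs1, Finset.sum_singleton] at this
          have := (mul_eq_zero.1 this).resolve_right (Real.exp_ne_zero _)
          rw [eq_C_of_natDegree_eq_zero hdeg, eval_C] at this
          apply hP m hm
          rw [eq_C_of_natDegree_eq_zero hdeg, this, C_0]
        simp [this]
      · have := ih (s.erase m) R T
          (fun l hl => (hRd l (Finset.mem_of_mem_erase hl) (Finset.ne_of_mem_erase hl)).1) hne
          (by rw [hsum]; omega) (by
            intro x hx
            have := hT0 x hx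
            rw [← Finset.add_sum_erase s _ hm, hR0] at this
            simpa using this)
        omega
    · have hlt : (R m).natDegree < (P m).natDegree := by
        rw [hRm]; exact natDegree_derivative_lt hdeg
      have hR0 : R m ≠ 0 := by
        rw [hRm]; intro h
        exact hdeg (derivative_eq_zero.1 h)
      have := ih s R T (fun l hl => by
          by_cases hlm : l = m
          · rw [hlm]; exact hR0
          · exact (hRd l hl hlm).1) ⟨m, hm⟩
          (by rw [← Finset.add_sum_erase s _ hm, hsum]; omega) hT0
      omega

theorem siegel_wrap {α β : Type} [Fintype α] [Fintype β] (A : Matrix α β ℤ) (C : ℕ) (hC : 1 ≤ C)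
    (hA : ∀ i j, |A i j| ≤ (C : ℤ)) (hcard : Fintype.card β = 2 * Fintype.card α)
    (hpos : 0 < Fintype.card α) :
    ∃ t : β → ℤ, t ≠ 0 ∧ (∀ i, ∑ j, A i j * t j = 0) ∧
      ∀ j, |t j| ≤ (Fintype.card β * C : ℤ) := by
  obtain ⟨t, ht0, ht, hb⟩ := Int.Matrix.exists_ne_zero_int_vec_norm_le A (by omega) hpos
  refine ⟨t, ht0, fun i => congrFun ht i, fun j => ?_⟩
  have he : ((Fintype.card α : ℝ) / ((Fintype.card β : ℝ) - Fintype.card α)) = 1 := by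
    have : (0 : ℝ) < Fintype.card α := by exact_mod_cast hpos
    rw [hcard]; push_cast
    rw [show (2 * (Fintype.card α : ℝ) - Fintype.card α) = Fintype.card α by ring]
    field_simp
  rw [he, Real.rpow_one] at hb
  have hC' : (1 : ℝ) ≤ C := by exact_mod_cast hC
  have hn : max 1 (@norm _ Matrix.seminormedAddCommGroup.toNorm A) ≤ (C : ℝ) := by
    refine max_le hC' ?_
    rw [Matrix.norm_le_iff (by positivity)]
    intro i j
    rw [Int.norm_eq_abs]
    exact_mod_cast hA i j
  have h1 : ‖t j‖ ≤ ‖t‖ := norm_le_pi_norm t j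
  rw [Int.norm_eq_abs] at h1
  have h2 : |(t j : ℝ)| ≤ Fintype.card β * C :=
    h1.trans (hb.trans (mul_le_mul_of_nonneg_left hn (by positivity)))
  exact_mod_cast h2

theorem deriv_bound (n k l K L X : ℕ) (hk : k < K) (hl : l < L) (hX : 1 ≤ X) (x : ℝ)
    (hx : x ∈ Set.Icc 0 (X : ℝ)) :
    |iteratedDeriv n (fun x : ℝ => x ^ k * Real.exp ((l * Real.log 2) * x)) x| ≤
      (2 ^ n * K ^ K * X ^ K * L ^ n * 2 ^ (L * X) : ℕ) := by
  have hc0 : 0 ≤ Real.log 2 := Real.log_nonneg (by norm_num)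
  have hc1 : Real.log 2 ≤ 1 := by have := Real.log_two_lt_d9; linarith
  have hX' : (1 : ℝ) ≤ X := by exact_mod_cast hX
  have hL' : (1 : ℝ) ≤ L := by exact_mod_cast (by omega : 1 ≤ L)
  have hK' : (1 : ℝ) ≤ K := by exact_mod_cast (by omega : 1 ≤ K)
  have hlL : (l : ℝ) ≤ L := by exact_mod_cast hl.le
  have hkK : (k : ℝ) ≤ K := by exact_mod_cast hk.le
  have hm := iteratedDeriv_mul (n := n) (x := x) (f := fun x : ℝ => x ^ k)
    (g := fun x : ℝ => Real.exp ((l * Real.log 2) * x))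
    (by fun_prop) (by fun_prop)
  have hmul : ((fun x : ℝ => x ^ k) * fun x : ℝ => Real.exp ((l * Real.log 2) * x)) =
    fun x : ℝ => x ^ k * Real.exp ((l * Real.log 2) * x) := rfl
  rw [hmul] at hm
  rw [hm]
  have hexp : Real.exp ((l * Real.log 2) * x) ≤ 2 ^ (L * X) := by
    have : (2 : ℝ) ^ (L * X) = Real.exp ((L * X : ℕ) * Real.log 2) := by
      rw [Real.exp_nat_mul, Real.exp_log (by norm_num)]
    rw [this]
    apply Real.exp_le_exp.2
    push_cast
    have : (l : ℝ) * x ≤ L * X := mul_le_mul hlL hx.2 hx.1 (by positivity)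
    nlinarith
  have hterm : ∀ i ∈ Finset.range (n + 1),
      |(n.choose i : ℝ) * iteratedDeriv i (fun x : ℝ => x ^ k) x *
        iteratedDeriv (n - i) (fun x : ℝ => Real.exp ((l * Real.log 2) * x)) x| ≤
      (n.choose i : ℝ) * (K ^ K * X ^ K * L ^ n * 2 ^ (L * X)) := by
    intro i _
    rw [iteratedDeriv_exp_const_mul]
    have h1 : |iteratedDeriv i (fun x : ℝ => x ^ k) x| ≤ K ^ K * X ^ K := by
      rw [iteratedDeriv_eq_iterate, iter_deriv_pow']
      by_cases hik : i ≤ k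
      · have h2 : |x ^ (k - i)| ≤ (X : ℝ) ^ K := by
          rw [abs_of_nonneg (pow_nonneg hx.1 _)]
          calc x ^ (k - i) ≤ (X : ℝ) ^ (k - i) := pow_le_pow_left₀ hx.1 hx.2 _
            _ ≤ X ^ K := pow_le_pow_right₀ hX' (by omega)
        have h3 : |∏ j ∈ Finset.range i, ((k : ℝ) - j)| ≤ (K : ℝ) ^ K := by
          rw [Finset.abs_prod]
          calc ∏ j ∈ Finset.range i, |(k : ℝ) - j| ≤ ∏ j ∈ Finset.range i, (K : ℝ) := by
                apply Finset.prod_le_prod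
                · intros; positivity
                · intro j hj
                  have : (j : ℝ) ≤ k := by
                    exact_mod_cast ((Finset.mem_range.1 hj).le.trans hik)
                  rw [abs_of_nonneg (by linarith)]
                  have : (0 : ℝ) ≤ j := by positivity
                  linarith
            _ = (K : ℝ) ^ i := by simp
            _ ≤ K ^ K := pow_le_pow_right₀ hK' (by omega)
        rw [abs_mul]
        exact mul_le_mul h3 h2 (abs_nonneg _) (by positivity)
      · have : ∏ j ∈ Finset.range i, ((k : ℝ) - j) = 0 :=
          Finset.prod_eq_zero (Finset.mem_range.2 (by omega : k < i)) (sub_self _)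
        simp only [this, zero_mul, abs_zero]; positivity
    have h4 : |(l * Real.log 2) ^ (n - i) * Real.exp ((l * Real.log 2) * x)| ≤
        L ^ n * 2 ^ (L * X) := by
      rw [abs_of_nonneg (by positivity)]
      refine mul_le_mul ?_ hexp (by positivity) (by positivity)
      calc (l * Real.log 2) ^ (n - i) ≤ (L : ℝ) ^ (n - i) := by
            refine pow_le_pow_left₀ (by positivity) ?_ _
            have : (0 : ℝ) ≤ l := by positivity
            nlinarith
        _ ≤ L ^ n := pow_le_pow_right₀ hL' (by omega)
    rw [mul_assoc, abs_mul, abs_mul, Nat.abs_cast]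
    refine mul_le_mul_of_nonneg_left ?_ (by positivity)
    calc _ ≤ ((K : ℝ) ^ K * X ^ K) * (L ^ n * 2 ^ (L * X)) :=
          mul_le_mul h1 h4 (abs_nonneg _) (by positivity)
      _ = _ := by ring
  refine (Finset.abs_sum_le_sum_abs _ _).trans ((Finset.sum_le_sum hterm).trans ?_)
  rw [← Finset.sum_mul]
  have : ∑ i ∈ Finset.range (n + 1), (n.choose i : ℝ) = 2 ^ n := by
    exact_mod_cast Nat.sum_range_choose n
  rw [this]
  push_cast
  apply le_of_eq; ring

theorem zs_bound (a b k : ℕ) : 0 ≤ ((⟨a, b⟩ : ℤ√2) ^ k).re ∧ 0 ≤ ((⟨a, b⟩ : ℤ√2) ^ k).im ∧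
    ((⟨a, b⟩ : ℤ√2) ^ k).re + ((⟨a, b⟩ : ℤ√2) ^ k).im ≤ ((a + 2 * b) ^ k : ℕ) := by
  induction k with
  | zero => simp
  | succ k ih =>
    obtain ⟨h1, h2, h3⟩ := ih
    simp only [pow_succ, Zsqrtd.re_mul, Zsqrtd.im_mul]
    refine ⟨by positivity, by positivity, ?_⟩
    push_cast at h3 ⊢
    have ha : (0 : ℤ) ≤ a := by positivity
    have hb : (0 : ℤ) ≤ b := by positivity
    nlinarith [mul_nonneg h1 hb]

/-- the integer multiplier -/
def coefE (p q B a b l : ℕ) : ℕ := 2 ^ (a * l) * p ^ (b * l) * q ^ (B - b * l)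

theorem coefE_bound (p q M L a b l : ℕ) (hp : 0 < p) (hq : 0 < q) (ha : a ≤ M) (hb : b ≤ M)
    (hl : l ≤ L) : coefE p q (M * L) a b l ≤ (2 * p * q) ^ (M * L) := by
  unfold coefE
  rw [mul_pow, mul_pow]
  have h1 : a * l ≤ M * L := Nat.mul_le_mul ha hl
  have h2 : b * l ≤ M * L := Nat.mul_le_mul hb hl
  gcongr <;> omega

theorem value_eq (p q B a b k l : ℕ) (hq : 0 < q)
    (hr : Real.exp (Real.log 2 * Real.sqrt 2) = p / q) (hB : b * l ≤ B) :
    (q : ℝ) ^ B * ((a + b * Real.sqrt 2) ^ k *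
      Real.exp ((l * Real.log 2) * (a + b * Real.sqrt 2))) =
    (((⟨a, b⟩ : ℤ√2) ^ k).re * (coefE p q B a b l : ℝ)) +
    (((⟨a, b⟩ : ℤ√2) ^ k).im * (coefE p q B a b l : ℝ)) * Real.sqrt 2 := by
  have hk : ((a : ℝ) + b * Real.sqrt 2) ^ k =
      ((⟨a, b⟩ : ℤ√2) ^ k).re + ((⟨a, b⟩ : ℤ√2) ^ k).im * Real.sqrt 2 := by
    have h := map_pow (Zsqrtd.toReal (d := 2) (by norm_num)) (⟨a, b⟩ : ℤ√2) k
    simp only [Zsqrtd.toReal_apply] at h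
    push_cast at h
    exact h.symm
  have he : Real.exp ((l * Real.log 2) * (a + b * Real.sqrt 2)) =
      2 ^ (a * l) * (p / q : ℝ) ^ (b * l) := by
    rw [show (l * Real.log 2) * (a + b * Real.sqrt 2) = ((a * l : ℕ) : ℝ) * Real.log 2 +
      ((b * l : ℕ) : ℝ) * (Real.log 2 * Real.sqrt 2) by push_cast; ring, Real.exp_add,
      Real.exp_nat_mul, Real.exp_nat_mul, hr, Real.exp_log (by norm_num)]
  have hq' : (q : ℝ) ≠ 0 := by positivity
  have hqB : (q : ℝ) ^ B = q ^ (B - b * l) * q ^ (b * l) := by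
    rw [← pow_add]; congr 1; omega
  rw [hk, he, hqB, div_pow]
  unfold coefE
  push_cast
  field_simp

theorem norm_lower (S T : ℤ) (h : (S : ℝ) + T * Real.sqrt 2 ≠ 0) :
    1 ≤ (|(S : ℝ)| + 2 * |(T : ℝ)|) * |(S : ℝ) + T * Real.sqrt 2| := by
  have hs : Real.sqrt 2 * Real.sqrt 2 = 2 := Real.mul_self_sqrt (by norm_num)
  have hs2 : Real.sqrt 2 ≤ 2 := by nlinarith [Real.sqrt_nonneg 2]
  have hne : S * S - 2 * (T * T) ≠ 0 := by
    intro h0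
    have h1 : (S * S - 2 * (T * T) : ℝ) = 0 := by exact_mod_cast h0
    have h2 : ((S : ℝ) + T * Real.sqrt 2) * (S - T * Real.sqrt 2) = 0 := by
      linear_combination h1 - T * T * hs
    have h3 := (mul_eq_zero.1 h2).resolve_left h
    by_cases hT : T = 0
    · subst hT; simp at h h3; exact h (by simp [h3])
    · apply irrational_sqrt_two
      refine ⟨(S : ℚ) / T, ?_⟩
      have hT' : (T : ℝ) ≠ 0 := by exact_mod_cast hT
      push_cast
      rw [div_eq_iff hT']; linarith
  have h1 : (1 : ℝ) ≤ |(S * S - 2 * (T * T) : ℝ)| := by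
    exact_mod_cast Int.one_le_abs hne
  have h2 : (S * S - 2 * (T * T) : ℝ) = (S - T * Real.sqrt 2) * (S + T * Real.sqrt 2) := by
    linear_combination T * T * hs
  rw [h2, abs_mul] at h1
  refine h1.trans (mul_le_mul_of_nonneg_right ?_ (abs_nonneg _))
  calc |(S : ℝ) - T * Real.sqrt 2| ≤ |(S : ℝ)| + |T * Real.sqrt 2| := abs_sub _ _
    _ = |(S : ℝ)| + |(T : ℝ)| * Real.sqrt 2 := by rw [abs_mul, abs_of_nonneg (Real.sqrt_nonneg 2)]
    _ ≤ _ := by nlinarith [abs_nonneg (T : ℝ)]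

noncomputable def auxF (K L : ℕ) (t : Fin K × Fin L → ℤ) (x : ℝ) : ℝ :=
  ∑ j, (t j : ℝ) * (x ^ (j.1 : ℕ) * Real.exp (((j.2 : ℕ) * Real.log 2) * x))

open Polynomial in
theorem auxF_nonvanish (K L : ℕ) (t : Fin K × Fin L → ℤ) (ht : t ≠ 0) (S : Finset ℝ)
    (hS : K * L ≤ S.card) : ∃ x ∈ S, auxF K L t x ≠ 0 := by
  classical
  by_contra! hcon
  have hlog : Real.log 2 ≠ 0 := (Real.log_pos (by norm_num)).ne'
  let P : ℝ → ℝ[X] := fun r => ∑ j : Fin K × Fin L,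
    if ((j.2 : ℕ) : ℝ) * Real.log 2 = r then C (t j : ℝ) * X ^ (j.1 : ℕ) else 0
  let s0 : Finset ℝ := Finset.univ.image (fun l : Fin L => ((l : ℕ) : ℝ) * Real.log 2)
  let s : Finset ℝ := s0.filter (fun r => P r ≠ 0)
  have hcoef : ∀ (k : Fin K) (l : Fin L),
      (P (((l : ℕ) : ℝ) * Real.log 2)).coeff (k : ℕ) = t (k, l) := by
    intro k l
    simp only [P, finsetSum_coeff]
    rw [Finset.sum_eq_single (k, l)]
    · simp
    · rintro ⟨k', l'⟩ _ hne
      by_cases h : ((l' : ℕ) : ℝ) * Real.log 2 = ((l : ℕ) : ℝ) * Real.log 2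
      · have h1 : l' = l := by
          have := mul_right_cancel₀ hlog h
          exact Fin.ext (by exact_mod_cast this)
        subst h1
        have h2 : (k : ℕ) ≠ k' := fun h => hne (by rw [Fin.ext h])
        simp [coeff_X_pow, h2]
      · simp [h]
    · simp
  obtain ⟨⟨k, l⟩, hkl⟩ := Function.ne_iff.1 ht
  have hsne : s.Nonempty := by
    refine ⟨((l : ℕ) : ℝ) * Real.log 2, Finset.mem_filter.2
      ⟨Finset.mem_image.2 ⟨l, Finset.mem_univ _, rfl⟩, ?_⟩⟩
    intro h0
    have := hcoef k l
    rw [h0, coeff_zero] at this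
    apply hkl
    simpa using this.symm
  have hdeg : ∀ r, (P r).natDegree + 1 ≤ K := by
    intro r
    have hK : 0 < K := k.pos
    have : (P r).natDegree ≤ K - 1 := by
      refine natDegree_sum_le_of_forall_le _ _ fun j _ => ?_
      have := j.1.isLt
      split_ifs
      · exact (natDegree_C_mul_X_pow_le _ _).trans (by omega)
      · simp
    omega
  have hsum : ∑ r ∈ s, ((P r).natDegree + 1) ≤ K * L := by
    calc ∑ r ∈ s, ((P r).natDegree + 1) ≤ ∑ r ∈ s, K := Finset.sum_le_sum fun r _ => hdeg r
      _ = s.card * K := by simp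
      _ ≤ L * K := by
        refine Nat.mul_le_mul_right _ ?_
        refine (Finset.card_filter_le _ _).trans (Finset.card_image_le.trans ?_)
        simp
      _ = K * L := mul_comm _ _
  have := exp_poly_zeros (K * L) s P S (fun r hr => (Finset.mem_filter.1 hr).2) hsne hsum (by
    intro x hx
    rw [← hcon x hx]
    rw [Finset.sum_filter_of_ne (by
      intro r _ h h0
      rw [h0] at h; simp at h)]
    simp only [P, eval_finsetSum, Finset.sum_mul, auxF]
    rw [Finset.sum_comm]
    refine Finset.sum_congr rfl fun j _ => ?_
    rw [Finset.sum_eq_single (((j.2 : ℕ) : ℝ) * Real.log 2)]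
    · simp; ring
    · intro r _ hr
      rw [if_neg hr.symm]; simp
    · intro h
      exact absurd (Finset.mem_image.2 ⟨j.2, Finset.mem_univ _, rfl⟩) h)
  omega

theorem auxF_contDiff (K L : ℕ) (t : Fin K × Fin L → ℤ) : ContDiff ℝ (⊤ : ℕ∞) (auxF K L t) := by
  unfold auxF
  fun_prop

theorem auxF_deriv_bound (n K L X G : ℕ) (t : Fin K × Fin L → ℤ) (ht : ∀ j, |t j| ≤ (G : ℤ))
    (hX : 1 ≤ X) (x : ℝ) (hx : x ∈ Set.Icc 0 (X : ℝ)) :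
    |iteratedDeriv n (auxF K L t) x| ≤
      (K * L * (G * (2 ^ n * K ^ K * X ^ K * L ^ n * 2 ^ (L * X))) : ℕ) := by
  unfold auxF
  rw [iteratedDeriv_fun_sum (fun j _ => by fun_prop)]
  refine (Finset.abs_sum_le_sum_abs _ _).trans ?_
  have : ∀ j ∈ (Finset.univ : Finset (Fin K × Fin L)), |iteratedDeriv n (fun x : ℝ =>
      (t j : ℝ) * (x ^ (j.1 : ℕ) * Real.exp (((j.2 : ℕ) * Real.log 2) * x))) x| ≤
      (G * (2 ^ n * K ^ K * X ^ K * L ^ n * 2 ^ (L * X)) : ℕ) := by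
    intro j _
    rw [iteratedDeriv_const_mul_field, abs_mul, Nat.cast_mul]
    refine mul_le_mul ?_ (deriv_bound n j.1 j.2 K L X j.1.isLt j.2.isLt hX x hx)
      (abs_nonneg _) (by positivity)
    exact_mod_cast ht j
  refine (Finset.sum_le_sum this).trans ?_
  rw [Finset.sum_const, nsmul_eq_mul]
  simp

theorem grid_inj : Function.Injective (fun ab : ℕ × ℕ => (ab.1 : ℝ) + ab.2 * Real.sqrt 2) := by
  rintro ⟨a, b⟩ ⟨c, d⟩ h
  simp only at h
  by_cases hbd : b = d
  · subst hbd
    have : (a : ℝ) = c := by linarith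
    have : a = c := by exact_mod_cast this
    rw [this]
  · exfalso
    have hne : (b : ℝ) - d ≠ 0 := sub_ne_zero.2 (by exact_mod_cast hbd)
    apply irrational_sqrt_two
    refine ⟨((c : ℚ) - a) / (b - d), ?_⟩
    push_cast
    rw [div_eq_iff hne]; linarith

noncomputable def grid (M : ℕ) : Finset ℝ :=
  (Finset.range M ×ˢ Finset.range M).map ⟨_, grid_inj⟩

theorem grid_card (M : ℕ) : (grid M).card = M ^ 2 := by
  simp [grid, sq]

theorem mem_grid {M : ℕ} {x : ℝ} (h : x ∈ grid M) :
    ∃ a b : ℕ, a < M ∧ b < M ∧ x = a + b * Real.sqrt 2 := by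
  obtain ⟨⟨a, b⟩, h1, rfl⟩ := Finset.mem_map.1 h
  simp only [Finset.mem_product, Finset.mem_range] at h1
  exact ⟨a, b, h1.1, h1.2, rfl⟩

theorem main_ineq (p q M K L : ℕ) (hp : 0 < p) (hq : 0 < q) (hM : 0 < M)
    (hKL : K * L = 4 * M ^ 2)
    (hr : Real.exp (Real.log 2 * Real.sqrt 2) = p / q) :
    ∀ A : ℕ, A = (6 * M) ^ K * (2 * p * q) ^ (2 * M * L) →
    (M ^ 2).factorial ≤ 2 * (K * L * (K * L * A) * A) * q ^ (2 * M * L) *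
      ((6 * M) ^ (M ^ 2) * (K * L * ((K * L * A) *
        (2 ^ (M ^ 2) * K ^ K * (6 * M) ^ K * L ^ (M ^ 2) * 2 ^ (L * (6 * M)))))) := by
  intro A hA
  have hA1 : 1 ≤ A := by rw [hA]; exact Nat.succ_le_of_lt (by positivity)
  set B := 2 * M * L with hB
  -- bound on entries
  have hent : ∀ a b : ℕ, a < 2 * M → b < 2 * M → ∀ j : Fin K × Fin L,
      (0 : ℤ) ≤ ((⟨a, b⟩ : ℤ√2) ^ (j.1 : ℕ)).re * (coefE p q B a b j.2 : ℤ) ∧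
      (0 : ℤ) ≤ ((⟨a, b⟩ : ℤ√2) ^ (j.1 : ℕ)).im * (coefE p q B a b j.2 : ℤ) ∧
      ((⟨a, b⟩ : ℤ√2) ^ (j.1 : ℕ)).re * (coefE p q B a b j.2 : ℤ) +
      ((⟨a, b⟩ : ℤ√2) ^ (j.1 : ℕ)).im * (coefE p q B a b j.2 : ℤ) ≤ A := by
    intro a b ha hb j
    obtain ⟨h1, h2, h3⟩ := zs_bound a b j.1
    refine ⟨by positivity, by positivity, ?_⟩
    rw [← add_mul]
    have h4 : (a + 2 * b) ^ (j.1 : ℕ) ≤ (6 * M) ^ K :=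
      (Nat.pow_le_pow_left (by omega : a + 2 * b ≤ 6 * M) _).trans
        (Nat.pow_le_pow_right (by omega) j.1.isLt.le)
    have h5 : coefE p q B a b j.2 ≤ (2 * p * q) ^ B :=
      coefE_bound p q (2 * M) L a b j.2 hp hq ha.le hb.le j.2.isLt.le
    have h6 : (a + 2 * b) ^ (j.1 : ℕ) * coefE p q B a b j.2 ≤ A := by
      rw [hA]; exact Nat.mul_le_mul h4 h5
    calc _ ≤ (((a + 2 * b) ^ (j.1 : ℕ) : ℕ) : ℤ) * (coefE p q B a b j.2 : ℤ) :=
          mul_le_mul_of_nonneg_right h3 (by positivity)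
      _ ≤ A := by exact_mod_cast h6
  obtain ⟨t, ht0, ht, htb⟩ := siegel_wrap
    (α := (Fin M × Fin M) × Bool) (β := Fin K × Fin L)
    (fun i j => (if i.2 then ((⟨(i.1.1 : ℕ), (i.1.2 : ℕ)⟩ : ℤ√2) ^ (j.1 : ℕ)).re
      else ((⟨(i.1.1 : ℕ), (i.1.2 : ℕ)⟩ : ℤ√2) ^ (j.1 : ℕ)).im) *
        (coefE p q B i.1.1 i.1.2 j.2 : ℤ)) A hA1 (by
      rintro ⟨⟨a, b⟩, c⟩ j
      have := hent a b (by omega) (by omega) j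
      cases c
      · simp only [Bool.false_eq_true, if_false]
        rw [abs_of_nonneg this.2.1]; linarith [this.1, this.2.2]
      · simp only [if_true]
        rw [abs_of_nonneg this.1]; linarith [this.2.1, this.2.2]) (by
      simp [hKL]; ring) (by simp; omega)
  have hcardβ : Fintype.card (Fin K × Fin L) = K * L := by simp
  rw [hcardβ] at htb
  have hval : ∀ a b : ℕ, a < 2 * M → b < 2 * M →
      (q : ℝ) ^ B * auxF K L t (a + b * Real.sqrt 2) =
      ((∑ j : Fin K × Fin L, ((⟨a, b⟩ : ℤ√2) ^ (j.1 : ℕ)).re * (coefE p q B a b j.2 : ℤ) * t j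
        : ℤ) : ℝ) +
      ((∑ j : Fin K × Fin L, ((⟨a, b⟩ : ℤ√2) ^ (j.1 : ℕ)).im * (coefE p q B a b j.2 : ℤ) * t j
        : ℤ) : ℝ) * Real.sqrt 2 := by
    intro a b ha hb
    unfold auxF
    push_cast
    rw [Finset.mul_sum, Finset.sum_mul, ← Finset.sum_add_distrib]
    refine Finset.sum_congr rfl fun j _ => ?_
    have := value_eq p q B a b j.1 j.2 hq hr (Nat.mul_le_mul hb.le j.2.isLt.le)
    linear_combination (t j : ℝ) * this
  have hq0 : (0 : ℝ) < (q : ℝ) ^ B := by positivity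
  have hzero : ∀ x ∈ grid M, auxF K L t x = 0 := by
    intro x hx
    obtain ⟨a, b, ha, hb, rfl⟩ := mem_grid hx
    have h1 := ht ((⟨a, ha⟩, ⟨b, hb⟩), true)
    have h2 := ht ((⟨a, ha⟩, ⟨b, hb⟩), false)
    simp only [if_true, Bool.false_eq_true, if_false] at h1 h2
    have := hval a b (by omega) (by omega)
    rw [h1, h2] at this
    simp only [Int.cast_zero, zero_mul, add_zero] at this
    exact (mul_eq_zero.1 this).resolve_left hq0.ne'
  have hs2 : Real.sqrt 2 ≤ 2 := by
    nlinarith [Real.sqrt_nonneg 2, Real.mul_self_sqrt (show (0:ℝ) ≤ 2 by norm_num)]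
  have hIcc : ∀ x ∈ grid (2 * M), x ∈ Set.Icc (0 : ℝ) ((6 * M : ℕ) : ℝ) := by
    intro x hx
    obtain ⟨a, b, ha, hb, rfl⟩ := mem_grid hx
    have ha' : (a : ℝ) ≤ 2 * M := by exact_mod_cast ha.le
    have hb' : (b : ℝ) ≤ 2 * M := by exact_mod_cast hb.le
    refine ⟨by positivity, ?_⟩
    push_cast
    have : (b : ℝ) * Real.sqrt 2 ≤ 2 * M * 2 :=
      mul_le_mul hb' hs2 (Real.sqrt_nonneg 2) (by positivity)
    linarith
  have hIcc' : ∀ x ∈ grid M, x ∈ Set.Icc (0 : ℝ) ((6 * M : ℕ) : ℝ) := by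
    intro x hx
    apply hIcc
    refine Finset.map_subset_map.2 ?_ hx
    exact Finset.product_subset_product (Finset.range_subset_range.2 (by omega))
      (Finset.range_subset_range.2 (by omega))
  obtain ⟨x, hx, hxne⟩ := auxF_nonvanish K L t ht0 (grid (2 * M)) (by
    rw [grid_card, hKL]; apply le_of_eq; ring)
  have hup := interp_bound ((6 * M : ℕ) : ℝ) _ (M ^ 2) (auxF K L t) (auxF_contDiff K L t) (grid M)
    (grid_card M) (fun y hy => ⟨hzero y hy, hIcc' y hy⟩)
    (fun y hy => auxF_deriv_bound (M ^ 2) K L (6 * M) (K * L * A) t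
      (fun j => by have := htb j; push_cast at this ⊢; exact this) (by omega) y hy) x (hIcc x hx)
  obtain ⟨a, b, ha, hb, rfl⟩ := mem_grid hx
  have hv := hval a b ha hb
  set Sv : ℤ := ∑ j : Fin K × Fin L,
    ((⟨a, b⟩ : ℤ√2) ^ (j.1 : ℕ)).re * (coefE p q B a b j.2 : ℤ) * t j with hSv
  set Tv : ℤ := ∑ j : Fin K × Fin L,
    ((⟨a, b⟩ : ℤ√2) ^ (j.1 : ℕ)).im * (coefE p q B a b j.2 : ℤ) * t j with hTv
  have hlow := norm_lower Sv Tv (by rw [← hv]; exact mul_ne_zero hq0.ne' hxne)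
  rw [← hv, abs_mul, abs_of_pos hq0] at hlow
  have hST : |Sv| + |Tv| ≤ ((K * L * (K * L * A) * A : ℕ) : ℤ) := by
    refine (add_le_add (Finset.abs_sum_le_sum_abs _ _) (Finset.abs_sum_le_sum_abs _ _)).trans ?_
    rw [← Finset.sum_add_distrib]
    have : ∀ j ∈ (Finset.univ : Finset (Fin K × Fin L)),
        |((⟨a, b⟩ : ℤ√2) ^ (j.1 : ℕ)).re * (coefE p q B a b j.2 : ℤ) * t j| +
        |((⟨a, b⟩ : ℤ√2) ^ (j.1 : ℕ)).im * (coefE p q B a b j.2 : ℤ) * t j| ≤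
        ((K * L * A * A : ℕ) : ℤ) := by
      intro j _
      obtain ⟨h1, h2, h3⟩ := hent a b ha hb j
      rw [abs_mul, abs_mul _ (t j), abs_of_nonneg h1, abs_of_nonneg h2, ← add_mul]
      have := mul_le_mul h3 (htb j) (abs_nonneg _) (by positivity)
      refine this.trans (le_of_eq ?_)
      push_cast; ring
    refine (Finset.sum_le_sum this).trans (le_of_eq ?_)
    rw [Finset.sum_const, nsmul_eq_mul, Finset.card_univ, hcardβ]
    push_cast; ring
  have hST' : |(Sv : ℝ)| + 2 * |(Tv : ℝ)| ≤ 2 * ((K * L * (K * L * A) * A : ℕ) : ℝ) := by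
    have : |(Sv : ℝ)| + |(Tv : ℝ)| ≤ ((K * L * (K * L * A) * A : ℕ) : ℝ) := by exact_mod_cast hST
    linarith [abs_nonneg (Sv : ℝ)]
  have hfac : (0 : ℝ) < ((M ^ 2).factorial : ℝ) := by exact_mod_cast (M ^ 2).factorial_pos
  rw [le_div_iff₀ hfac] at hup
  have hfin : ((M ^ 2).factorial : ℝ) ≤ 2 * ((K * L * (K * L * A) * A : ℕ) : ℝ) * (q : ℝ) ^ B *
      (((6 * M : ℕ) : ℝ) ^ (M ^ 2) * ((K * L * ((K * L * A) *
        (2 ^ (M ^ 2) * K ^ K * (6 * M) ^ K * L ^ (M ^ 2) * 2 ^ (L * (6 * M)))) : ℕ) : ℝ)) := by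
    set Fx := |auxF K L t (a + b * Real.sqrt 2)| with hFx
    calc ((M ^ 2).factorial : ℝ) = 1 * ((M ^ 2).factorial : ℝ) := (one_mul _).symm
      _ ≤ ((|(Sv : ℝ)| + 2 * |(Tv : ℝ)|) * ((q : ℝ) ^ B * Fx)) * ((M ^ 2).factorial : ℝ) :=
          mul_le_mul_of_nonneg_right hlow hfac.le
      _ = (|(Sv : ℝ)| + 2 * |(Tv : ℝ)|) * (q : ℝ) ^ B * (Fx * ((M ^ 2).factorial : ℝ)) := by ring
      _ ≤ _ := by
        refine mul_le_mul (mul_le_mul_of_nonneg_right hST' hq0.le) hup ?_ ?_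
        · positivity
        · positivity
  exact_mod_cast hfin

theorem pow_le_factorial (n : ℕ) : n ^ n ≤ 3 ^ n * n.factorial := by
  have h := Real.pow_div_factorial_le_exp (x := (n : ℝ)) (by positivity) n
  have hfac : (0 : ℝ) < n.factorial := by exact_mod_cast n.factorial_pos
  rw [div_le_iff₀ hfac] at h
  have he : Real.exp n ≤ 3 ^ n := by
    have : Real.exp n = Real.exp 1 ^ n := by rw [← Real.exp_nat_mul, mul_one]
    rw [this]
    exact pow_le_pow_left₀ (Real.exp_pos _).le (by have := Real.exp_one_lt_d9; linarith) _
  have : (n : ℝ) ^ n ≤ 3 ^ n * n.factorial :=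
    h.trans (mul_le_mul_of_nonneg_right he hfac.le)
  exact_mod_cast this

theorem final_ineq (p q m : ℕ) (hp : 0 < p) (hq : 0 < q) (hm : 72 ≤ m)
    (hr : Real.exp (Real.log 2 * Real.sqrt 2) = p / q) :
    2 ^ m ≤ (2 * 4 ^ 4 * 6 ^ 12 * (2 * p * q) ^ 6 * q ^ 2 * 24 ^ 4 * 64) * m ^ 60 := by
  have hm0 : 0 < m := by omega
  have h := main_ineq p q (m ^ 2) (4 * m ^ 3) m hp hq (by positivity) (by ring) hr _ rfl
  set Q := 2 * p * q with hQ
  have hn : (m ^ 2) ^ 2 = m ^ 4 := by ring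
  have hN : 4 * m ^ 3 * m = 4 * m ^ 4 := by ring
  rw [hn, hN] at h
  have hA : (6 * m ^ 2) ^ (4 * m ^ 3) * Q ^ (2 * m ^ 2 * m) =
      ((6 * m ^ 2) ^ 4 * Q ^ 2) ^ (m ^ 3) := by
    rw [show 2 * m ^ 2 * m = 2 * m ^ 3 by ring, pow_mul, pow_mul, ← mul_pow]
  rw [hA] at h
  have hqB : q ^ (2 * m ^ 2 * m) = (q ^ 2) ^ (m ^ 3) := by
    rw [show 2 * m ^ 2 * m = 2 * m ^ 3 by ring, pow_mul]
  have h2 : 2 ^ (m * (6 * m ^ 2)) = 64 ^ (m ^ 3) := by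
    rw [show m * (6 * m ^ 2) = 6 * m ^ 3 by ring, pow_mul]; norm_num
  rw [hqB, h2, pow_mul (4 * m ^ 3), pow_mul (6 * m ^ 2) 4] at h
  set e := m ^ 3 with he
  have he1 : e ≠ 0 := by rw [he]; positivity
  set V := (2 * 4 ^ 4 * 6 ^ 12 * Q ^ 6 * q ^ 2 * 24 ^ 4 * 64) * m ^ 60 with hV
  have hV' : V = (2 * (4 * m ^ 4) ^ 4) * ((6 * m ^ 2) ^ 4 * Q ^ 2) ^ 3 * q ^ 2 *
      ((4 * e) ^ 4 * (6 * m ^ 2) ^ 4) * 64 := by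
    rw [hV, he]; ring
  set n := m ^ 4 with hnn
  have h3 : n.factorial ≤ (12 * m ^ 3) ^ n * V ^ e := by
    refine h.trans ?_
    have h4 : 2 * (4 * n) ^ 4 ≤ (2 * (4 * n) ^ 4) ^ e := Nat.le_self_pow he1 _
    have hnp : (12 * m ^ 3) ^ n = (6 * m ^ 2) ^ n * 2 ^ n * m ^ n := by
      rw [← mul_pow, ← mul_pow]; congr 1; ring
    rw [hV', hnp, mul_pow _ 64 e, mul_pow _ ((4 * e) ^ 4 * (6 * m ^ 2) ^ 4) e, mul_pow _ (q ^ 2) e,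
      mul_pow (2 * (4 * n) ^ 4) _ e, mul_pow ((4 * e) ^ 4) _ e, pow_right_comm _ 3 e]
    generalize ((6 * m ^ 2) ^ 4 * Q ^ 2) ^ e = A
    generalize ((4 * e) ^ 4) ^ e = x1
    generalize ((6 * m ^ 2) ^ 4) ^ e = x2
    generalize (6 * m ^ 2) ^ n = x3
    generalize (q ^ 2) ^ e = x4
    generalize 64 ^ e = x5
    generalize 2 ^ n = x6
    generalize m ^ n = x7
    generalize (2 * (4 * n) ^ 4) ^ e = x8 at *
    calc _ = (2 * (4 * n) ^ 4) * (A ^ 3 * x4 * (x1 * x2) * x5 * (x3 * x6 * x7)) := by ring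
      _ ≤ x8 * (A ^ 3 * x4 * (x1 * x2) * x5 * (x3 * x6 * x7)) := Nat.mul_le_mul_right _ h4
      _ = _ := by ring
  have h5 : (36 * m ^ 3) ^ n * m ^ n ≤ (36 * m ^ 3) ^ n * (36 ^ n * V ^ e) := by
    calc (36 * m ^ 3) ^ n * m ^ n = 36 ^ n * n ^ n := by
          rw [← mul_pow, ← mul_pow]; congr 1; rw [hnn]; ring
      _ ≤ 36 ^ n * (3 ^ n * n.factorial) := Nat.mul_le_mul_left _ (pow_le_factorial n)
      _ ≤ 36 ^ n * (3 ^ n * ((12 * m ^ 3) ^ n * V ^ e)) := by gcongr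
      _ = 36 ^ n * ((36 * m ^ 3) ^ n * V ^ e) := by
          rw [← mul_assoc (3 ^ n), ← mul_pow, ← mul_assoc 3]; norm_num
      _ = _ := by ring
  have h6 : m ^ n ≤ 36 ^ n * V ^ e := Nat.le_of_mul_le_mul_left h5 (by positivity)
  have h7 : 36 ^ n * 2 ^ n ≤ 36 ^ n * V ^ e := by
    rw [← mul_pow]
    exact (Nat.pow_le_pow_left (by omega) n).trans h6
  have h8 : 2 ^ n ≤ V ^ e := Nat.le_of_mul_le_mul_left h7 (by positivity)
  have h9 : 2 ^ n = (2 ^ m) ^ e := by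
    rw [← pow_mul, hnn, he]; congr 1; ring
  rw [h9] at h8
  exact (Nat.pow_le_pow_iff_left he1).1 h8

theorem two_rpow_ne (p q : ℕ) (hp : 0 < p) (hq : 0 < q) :
    Real.exp (Real.log 2 * Real.sqrt 2) ≠ p / q := by
  intro hr
  set C : ℕ := 2 * 4 ^ 4 * 6 ^ 12 * (2 * p * q) ^ 6 * q ^ 2 * 24 ^ 4 * 64 with hC
  have hC0 : (0 : ℝ) < C := by rw [hC]; positivity
  have hlim := tendsto_pow_const_div_const_pow_of_one_lt 60 (r := (2 : ℝ)) (by norm_num)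
  have hev := hlim.eventually_lt_const (u := 1 / (C : ℝ)) (by positivity)
  obtain ⟨m, h1, h2⟩ := (hev.and (Filter.eventually_ge_atTop 72)).exists
  have h3 := final_ineq p q m hp hq h2 hr
  rw [← hC] at h3
  have h4 : (2 : ℝ) ^ m ≤ C * m ^ 60 := by exact_mod_cast h3
  rw [div_lt_div_iff₀ (by positivity) hC0] at h1
  linarith

theorem irrational_sqrt_two_rpow_sqrt_two :
    Irrational ((Real.sqrt 2) ^ (Real.sqrt 2)) := by
  rintro ⟨r, hr⟩
  have hs : 0 < Real.sqrt 2 := Real.sqrt_pos.2 (by norm_num)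
  have hpos : (0 : ℝ) < (Real.sqrt 2) ^ (Real.sqrt 2) := Real.rpow_pos_of_pos hs _
  have hr0 : 0 < r := by rw [← hr] at hpos; exact_mod_cast hpos
  have hnum : 0 < r.num := Rat.num_pos.2 hr0
  have hsq : Real.exp (Real.log 2 * Real.sqrt 2) = (r : ℝ) ^ 2 := by
    rw [hr, Real.rpow_def_of_pos hs, ← Real.exp_nat_mul, Real.log_sqrt (by norm_num)]
    congr 1; push_cast; ring
  refine two_rpow_ne (r.num.toNat ^ 2) (r.den ^ 2)
    (by have : 0 < r.num.toNat := by omega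
        positivity)
    (by have := r.den_pos; positivity) ?_
  rw [hsq]
  have h1 : (r : ℝ) = (r.num : ℝ) / r.den := Rat.cast_def r
  have h2 : ((r.num.toNat : ℕ) : ℝ) = (r.num : ℝ) := by
    have : ((r.num.toNat : ℕ) : ℤ) = r.num := Int.toNat_of_nonneg hnum.le
    exact_mod_cast congrArg (Int.cast : ℤ → ℝ) this
  push_cast
  rw [h2, h1, div_pow]
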